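/- For every s ∈ S, the source map F ↦ d(F) is injective on the set of proper filters in S containing s; that is, if F and G are proper filters with s ∈ F, s ∈ G and d(F) = d(G), then F = G (the set of proper filters containing s is a local bisection). -/

import Mathlib

/-- An inverse semigroup with zero: every element `a` has a unique `a⁻¹` with
`a * a⁻¹ * a = a` and `a⁻¹ * a * a⁻¹ = a⁻¹`, and `0` is absorbing. -/
class InvSemigroupWithZero (S : Type*) extends Semigroup S, Zero S, Inv S where
  mul_inv_mul : ∀ a : S, a * a⁻¹ * a = a
  inv_mul_inv : ∀ a : S, a⁻¹ * a * a⁻¹ = a⁻¹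
  inv_unique : ∀ a b : S, a * b * a = a → b * a * b = b → b = a⁻¹
  zero_mul : ∀ a : S, 0 * a = 0
  mul_zero : ∀ a : S, a * 0 = 0

namespace InvSemigroupWithZero

variable {S : Type*} [InvSemigroupWithZero S]

/-- The natural partial order on `S`: `a ≤ b` iff `a = a * a⁻¹ * b`. -/
def sle (a b : S) : Prop := a = a * a⁻¹ * b

/-- `↓s`, the down-set of `s` w.r.t. the natural partial order. -/
def dwn (s : S) : Set S := {t : S | sle t s}

/-- `↑A`, the up-set generated by `A` w.r.t. the natural partial order. -/
def up (A : Set S) : Set S := {b : S | ∃ a ∈ A, sle a b}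

/-- A filter in `S`: a nonempty down-directed up-set. -/
def IsFilt (F : Set S) : Prop :=
  F.Nonempty ∧ up F = F ∧ ∀ a ∈ F, ∀ b ∈ F, ∃ c ∈ F, sle c a ∧ sle c b

/-- A proper filter: a filter not containing `0`. -/
def IsPFilt (F : Set S) : Prop := IsFilt F ∧ (0 : S) ∉ F

/-- An ultrafilter: a proper filter maximal among proper filters. -/
def IsUltra (U : Set S) : Prop :=
  IsPFilt U ∧ ∀ G : Set S, IsPFilt G → U ⊆ G → U = G

/-- The set `E` of idempotents of `S`. -/
def E (S : Type*) [InvSemigroupWithZero S] : Set S := {e : S | e * e = e}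

/-- `F⁻¹ = {a⁻¹ : a ∈ F}`. -/
def finv (F : Set S) : Set S := (fun a : S => a⁻¹) '' F

/-- `F · G = ↑{fg : f ∈ F, g ∈ G}`. -/
def fmul (F G : Set S) : Set S := up (Set.image2 (· * ·) F G)

/-- The source `d(F) := F⁻¹ · F`. -/
def src (F : Set S) : Set S := fmul (finv F) F

/-- The range `r(F) := F · F⁻¹`. -/
def rng (F : Set S) : Set S := fmul F (finv F)

/-- The natural partial order on the idempotents: `e ≤ f` iff `e = e * f`. -/
def ele (e f : S) : Prop := e = e * f

/-- The down-set of an idempotent `e` inside `E`. -/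
def edwn (e : S) : Set S := {f : S | f ∈ E S ∧ ele f e}

/-- The up-set generated by `A` inside `E`. -/
def eup (A : Set S) : Set S := {f : S | f ∈ E S ∧ ∃ a ∈ A, ele a f}

/-- An `E`-filter: a proper filter of the inverse semigroup `E` of idempotents. -/
def IsEFilt (ξ : Set S) : Prop :=
  ξ ⊆ E S ∧ ξ.Nonempty ∧ eup ξ = ξ ∧
    (∀ a ∈ ξ, ∀ b ∈ ξ, ∃ c ∈ ξ, ele c a ∧ ele c b) ∧ (0 : S) ∉ ξ

/-- An `E`-ultrafilter: an `E`-filter maximal among `E`-filters. -/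
def IsEUltra (ξ : Set S) : Prop :=
  IsEFilt ξ ∧ ∀ η : Set S, IsEFilt η → ξ ⊆ η → ξ = η

/-- `β_s(ξ) = {f ∈ E : s·e·s⁻¹ ≤ f for some e ∈ ξ}`. -/
def beta (s : S) (ξ : Set S) : Set S :=
  {f : S | f ∈ E S ∧ ∃ e ∈ ξ, sle (s * e * s⁻¹) f}

/-- The set of proper filters in `S`. -/
abbrev PFilt (S : Type*) [InvSemigroupWithZero S] := {F : Set S // IsPFilt F}

/-- The patch topology on the set of proper filters, generated by the sets
`F(s;T) = {F : s ∈ F, F ∩ T = ∅}` for `s ∈ S` and finite `T ⊆ ↓s`. -/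
instance patchTopology : TopologicalSpace (PFilt S) :=
  TopologicalSpace.generateFrom
    {O : Set (PFilt S) | ∃ (s : S) (T : Set S), T.Finite ∧ T ⊆ dwn s ∧
      O = {F : PFilt S | s ∈ F.1 ∧ F.1 ∩ T = ∅}}

/-- The set of idempotent proper filters in `S`. -/
abbrev IPFilt (S : Type*) [InvSemigroupWithZero S] :=
  {F : Set S // IsPFilt F ∧ (F ∩ E S).Nonempty}

/-- The subspace topology induced by the patch topology on proper filters. -/
instance : TopologicalSpace (IPFilt S) :=
  TopologicalSpace.induced (fun F => (⟨F.1, F.2.1⟩ : PFilt S)) inferInstance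

/-- The set of `E`-filters. -/
abbrev EFilt (S : Type*) [InvSemigroupWithZero S] := {ξ : Set S // IsEFilt ξ}

/-- The patch topology on the set of `E`-filters, generated by the sets
`P(e;X) = {ξ : e ∈ ξ, ξ ∩ X = ∅}` for `e ∈ E` and finite `X ⊆ ↓e ∩ E`. -/
instance : TopologicalSpace (EFilt S) :=
  TopologicalSpace.generateFrom
    {O : Set (EFilt S) | ∃ (e : S) (X : Set S), e ∈ E S ∧ X.Finite ∧ X ⊆ edwn e ∧
      O = {ξ : EFilt S | e ∈ ξ.1 ∧ ξ.1 ∩ X = ∅}}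

/-- The set of ultrafilters in `S`. -/
abbrev UFilt (S : Type*) [InvSemigroupWithZero S] := {U : Set S // IsUltra U}

/-- The subspace topology induced by the patch topology on proper filters. -/
instance : TopologicalSpace (UFilt S) :=
  TopologicalSpace.induced (fun U => (⟨U.1, U.2.1⟩ : PFilt S)) inferInstance

end InvSemigroupWithZero

open InvSemigroupWithZero

namespace InvSemigroupWithZero

variable {S : Type*} [InvSemigroupWithZero S]

theorem inv_inv' (a : S) : a⁻¹⁻¹ = a :=
  (inv_unique a⁻¹ a (inv_mul_inv a) (mul_inv_mul a)).symm

theorem inv_eq_self_of_idem {e : S} (he : e * e = e) : e⁻¹ = e :=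
  (inv_unique e e (by rw [he, he]) (by rw [he, he])).symm

theorem idem_inv_mul (a : S) : a⁻¹ * a * (a⁻¹ * a) = a⁻¹ * a := by
  rw [← mul_assoc, inv_mul_inv]

theorem idem_mul_inv (a : S) : a * a⁻¹ * (a * a⁻¹) = a * a⁻¹ := by
  rw [← mul_assoc, mul_inv_mul]

theorem idem_mul {e f : S} (he : e * e = e) (hf : f * f = f) :
    e * f * (e * f) = e * f := by
  have h₁ := mul_inv_mul (e * f)
  have h₂ := inv_mul_inv (e * f)
  set x := (e * f)⁻¹ with hx
  have hfxe : f * x * e = x := by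
    refine inv_unique (e * f) (f * x * e) ?_ ?_
    · calc e * f * (f * x * e) * (e * f) = e * (f * f) * x * (e * e) * f := by
            simp only [mul_assoc]
        _ = e * f * x * (e * f) := by rw [he, hf]; simp only [mul_assoc]
        _ = e * f := h₁
    · calc f * x * e * (e * f) * (f * x * e) = f * x * (e * e) * (f * f) * x * e := by
            simp only [mul_assoc]
        _ = f * (x * (e * f) * x) * e := by rw [he, hf]; simp only [mul_assoc]
        _ = f * x * e := by rw [h₂]
  have hxx : x * x = x := by
    calc x * x = f * x * e * (f * x * e) := by rw [hfxe]
      _ = f * (x * (e * f) * x) * e := by simp only [mul_assoc]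
      _ = x := by rw [h₂, hfxe]
  have hef : e * f = x := by rw [← inv_inv' (e * f), ← hx, inv_eq_self_of_idem hxx]
  rw [hef, hxx]

theorem idem_comm {e f : S} (he : e * e = e) (hf : f * f = f) : e * f = f * e := by
  have h₁ := idem_mul he hf
  have h₂ := idem_mul hf he
  have h : f * e = (e * f)⁻¹ := by
    refine inv_unique (e * f) (f * e) ?_ ?_
    · calc e * f * (f * e) * (e * f) = e * (f * f) * (e * e) * f := by simp only [mul_assoc]
        _ = e * f * (e * f) := by rw [he, hf]; simp only [mul_assoc]
        _ = e * f := h₁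
    · calc f * e * (e * f) * (f * e) = f * (e * e) * (f * f) * e := by simp only [mul_assoc]
        _ = f * e * (f * e) := by rw [he, hf]; simp only [mul_assoc]
        _ = f * e := h₂
  rw [h, inv_eq_self_of_idem h₁]

theorem mul_inv_rev' (a b : S) : (a * b)⁻¹ = b⁻¹ * a⁻¹ := by
  have hc : b * b⁻¹ * (a⁻¹ * a) = a⁻¹ * a * (b * b⁻¹) :=
    idem_comm (idem_mul_inv b) (idem_inv_mul a)
  refine (inv_unique (a * b) (b⁻¹ * a⁻¹) ?_ ?_).symm
  · calc a * b * (b⁻¹ * a⁻¹) * (a * b) = a * (b * b⁻¹ * (a⁻¹ * a)) * b := by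
          simp only [mul_assoc]
      _ = a * a⁻¹ * a * (b * b⁻¹ * b) := by rw [hc]; simp only [mul_assoc]
      _ = a * b := by rw [mul_inv_mul, mul_inv_mul]
  · calc b⁻¹ * a⁻¹ * (a * b) * (b⁻¹ * a⁻¹) = b⁻¹ * (a⁻¹ * a * (b * b⁻¹)) * a⁻¹ := by
          simp only [mul_assoc]
      _ = b⁻¹ * b * b⁻¹ * (a⁻¹ * a * a⁻¹) := by rw [← hc]; simp only [mul_assoc]
      _ = b⁻¹ * a⁻¹ := by rw [inv_mul_inv, inv_mul_inv]

theorem sle_refl (a : S) : sle a a := (mul_inv_mul a).symm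

theorem idem_mul_sle {e : S} (he : e * e = e) (b : S) : sle (e * b) b := by
  have hc : b * b⁻¹ * e = e * (b * b⁻¹) := idem_comm (idem_mul_inv b) he
  refine Eq.symm (a := e * b * (e * b)⁻¹ * b) ?_
  calc e * b * (e * b)⁻¹ * b = e * (b * b⁻¹ * e) * b := by
        rw [mul_inv_rev', inv_eq_self_of_idem he]; simp only [mul_assoc]
    _ = e * e * (b * b⁻¹ * b) := by rw [hc]; simp only [mul_assoc]
    _ = e * b := by rw [he, mul_inv_mul]

theorem sle_trans {a b c : S} (hab : sle a b) (hbc : sle b c) : sle a c := by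
  have h : a = a * a⁻¹ * (b * b⁻¹) * c := by
    rw [mul_assoc _ (b * b⁻¹), ← hbc]; exact hab
  rw [h]
  exact idem_mul_sle (idem_mul (idem_mul_inv a) (idem_mul_inv b)) c

theorem mul_idem_sle {e : S} (he : e * e = e) (b : S) : sle (b * e) b := by
  have hc : b⁻¹ * b * e = e * (b⁻¹ * b) := idem_comm (idem_inv_mul b) he
  have h : b * e = b * e * b⁻¹ * b := by
    calc b * e = b * b⁻¹ * b * e := by rw [mul_inv_mul]
      _ = b * (b⁻¹ * b * e) := by simp only [mul_assoc]
      _ = b * e * b⁻¹ * b := by rw [hc]; simp only [mul_assoc]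
  rw [h]
  refine idem_mul_sle ?_ b
  calc b * e * b⁻¹ * (b * e * b⁻¹) = b * e * b⁻¹ * b * e * b⁻¹ := by simp only [mul_assoc]
    _ = b * (e * e) * b⁻¹ := by rw [← h]; simp only [mul_assoc]
    _ = b * e * b⁻¹ := by rw [he]

theorem eq_mul_inv_mul_of_sle {a b : S} (h : sle a b) : a = b * (a⁻¹ * a) := by
  have hg := idem_mul_inv a
  have h' : a = a * a⁻¹ * b := h
  set g := a * a⁻¹ with hgdef
  have hc : b * b⁻¹ * g = g * (b * b⁻¹) := idem_comm (idem_mul_inv b) hg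
  have hi : a⁻¹ * a = b⁻¹ * g * b := by
    rw [h', mul_inv_rev', inv_eq_self_of_idem hg]
    calc b⁻¹ * g * (g * b) = b⁻¹ * (g * g) * b := by simp only [mul_assoc]
      _ = b⁻¹ * g * b := by rw [hg]
  rw [hi]
  symm
  calc b * (b⁻¹ * g * b) = b * b⁻¹ * g * b := by simp only [mul_assoc]
    _ = g * (b * b⁻¹ * b) := by rw [hc]; simp only [mul_assoc]
    _ = a := by rw [mul_inv_mul, ← h']

theorem inv_mul_self_sle {x y z : S} (hx : sle z x) (hy : sle z y) :
    sle (z⁻¹ * z) (x⁻¹ * y) := by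
  have hp := idem_inv_mul z
  have hzx := eq_mul_inv_mul_of_sle hx
  have hzy := eq_mul_inv_mul_of_sle hy
  set p := z⁻¹ * z with hpdef
  have hzi : z⁻¹ = p * x⁻¹ := by
    rw [← inv_eq_self_of_idem hp, ← mul_inv_rev', ← hzx]
  have h : p = p * (x⁻¹ * y) * p := by
    calc p = z⁻¹ * z := hpdef
      _ = p * x⁻¹ * (y * p) := by rw [← hzi, ← hzy]
      _ = p * (x⁻¹ * y) * p := by simp only [mul_assoc]
  rw [h]
  exact sle_trans (mul_idem_sle hp _) (idem_mul_sle hp _)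

theorem sle_of_inv_mul_self_sle {s c z : S} (hc : sle c s) (hz : sle z s)
    (h : sle (z⁻¹ * z) (c⁻¹ * c)) : sle z c := by
  have hp := idem_inv_mul z
  have hq := idem_inv_mul c
  have hpq : z⁻¹ * z = z⁻¹ * z * (c⁻¹ * c) := by
    have h' : z⁻¹ * z = z⁻¹ * z * (z⁻¹ * z)⁻¹ * (c⁻¹ * c) := h
    rwa [inv_eq_self_of_idem hp, hp] at h'
  have hzc : z = c * (z⁻¹ * z) := by
    calc z = s * (z⁻¹ * z) := eq_mul_inv_mul_of_sle hz
      _ = s * (c⁻¹ * c * (z⁻¹ * z)) := by rw [idem_comm hq hp, ← hpq]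
      _ = s * (c⁻¹ * c) * (z⁻¹ * z) := by simp only [mul_assoc]
      _ = c * (z⁻¹ * z) := by rw [← eq_mul_inv_mul_of_sle hc]
  rw [hzc]
  exact mul_idem_sle hp c

theorem IsFilt.mem_of_sle {F : Set S} (hF : IsFilt F) {a b : S} (ha : a ∈ F)
    (hab : sle a b) : b ∈ F := by
  rw [← hF.2.1]
  exact ⟨a, ha, hab⟩

theorem IsFilt.subset_of_src_subset {F G : Set S} (hF : IsFilt F) (hG : IsFilt G) {s : S}
    (hsF : s ∈ F) (hsG : s ∈ G) (hd : src F ⊆ src G) : F ⊆ G := by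
  intro a ha
  obtain ⟨c, hc, hca, hcs⟩ := hF.2.2 a ha s hsF
  obtain ⟨_, ⟨_, ⟨x, hx, rfl⟩, y, hy, rfl⟩, hxy⟩ : c⁻¹ * c ∈ src G :=
    hd ⟨c⁻¹ * c, ⟨c⁻¹, ⟨c, hc, rfl⟩, c, hc, rfl⟩, sle_refl _⟩
  obtain ⟨w, hw, hwx, hwy⟩ := hG.2.2 x hx y hy
  obtain ⟨z, hz, hzw, hzs⟩ := hG.2.2 w hw s hsG
  have hzc : sle z c := sle_of_inv_mul_self_sle hcs hzs
    (sle_trans (inv_mul_self_sle (sle_trans hzw hwx) (sle_trans hzw hwy)) hxy)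
  exact hG.mem_of_sle hz (sle_trans hzc hca)

end InvSemigroupWithZero

/-- For every `s ∈ S`, the source map `F ↦ d(F)` is injective on the proper
filters containing `s` (the set of proper filters containing `s` is a local bisection). -/
theorem stmt_9 {S : Type*} [InvSemigroupWithZero S] (s : S)
    (F G : Set S) (hF : IsPFilt F) (hG : IsPFilt G)
    (hsF : s ∈ F) (hsG : s ∈ G) (hd : src F = src G) : F = G := by
  exact (hF.1.subset_of_src_subset hG.1 hsF hsG hd.le).antisymm
    (hG.1.subset_of_src_subset hF.1 hsG hsF hd.ge)
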